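/- arXiv:1404.2755 — 2 statements merged into one kernel-verified Lean document; each statement's English description precedes it below -/
import Mathlib

section
/- Let k be a field and I = (f_1,…,f_s) an ideal of R = k[x_1,…,x_n]. Then there exist a polynomial ring S = R[y_1,…,y_r] and a surjective homomorphism of R-algebras σ : S → R such that σ^{-1}(I) is an ideal of S generated by trinomials (polynomials with at most three monomial terms) and such that rt(I) = rt(σ^{-1}(I)). -/
open Polynomial MvPolynomial

/-- The kernel of the graded presentation `R[t₁,…,t_s] → 𝐑(I) ⊆ R[X]` of the Rees algebra
of the ideal generated by `f`, sending `tᵢ` to `(f i)·X`. -/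
noncomputable def reesKer {R : Type*} [CommRing R] {s : ℕ} (f : Fin s → R) :
    Ideal (MvPolynomial (Fin s) R) :=
  RingHom.ker (MvPolynomial.aeval
    (fun i => Polynomial.C (f i) * Polynomial.X) : MvPolynomial (Fin s) R →ₐ[R] Polynomial R)

/-- `L` is generated by its homogeneous elements of degree at most `N`. -/
def GenInDegLE {R : Type*} [CommRing R] {s : ℕ}
    (L : Ideal (MvPolynomial (Fin s) R)) (N : ℕ) : Prop :=
  L = Ideal.span {p | p ∈ L ∧ ∃ q ≤ N, MvPolynomial.IsHomogeneous p q}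

/-- The relation type of an ideal `I`: the least `N ≥ 1` such that, for every finite
generating family of `I`, the ideal of equations of the corresponding presentation of the
Rees algebra is generated by its homogeneous elements of degree at most `N`. -/
noncomputable def relType {R : Type*} [CommRing R] (I : Ideal R) : ℕ :=
  sInf {N | 1 ≤ N ∧ ∀ (s : ℕ) (f : Fin s → R),
    Ideal.span (Set.range f) = I → GenInDegLE (reesKer f) N}

/-- A polynomial in `S = R[y₁,…,y_r]`, `R = k[x₁,…,xₙ]`, is a *trinomial* if it has at most
three monomial terms (counting monomials in all of the variables `x` and `y`). -/
def IsTrinomial {k : Type*} [Field k] {n r : ℕ}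
    (p : MvPolynomial (Fin r) (MvPolynomial (Fin n) k)) : Prop :=
  ∑ α ∈ p.support, (p.coeff α).support.card ≤ 3

/-- `reesKer` for a family indexed by an arbitrary type. -/
noncomputable def reesEquations {R ι : Type*} [CommRing R] (f : ι → R) :
    Ideal (MvPolynomial ι R) :=
  RingHom.ker (MvPolynomial.aeval
    (fun i => Polynomial.C (f i) * Polynomial.X) : MvPolynomial ι R →ₐ[R] Polynomial R)

/-- The ideal generated by the homogeneous elements of `L` of degree at most `N`. -/
noncomputable def lowDegreePart {R ι : Type*} [CommRing R] (L : Ideal (MvPolynomial ι R))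
    (N : ℕ) : Ideal (MvPolynomial ι R) :=
  Ideal.span {p | p ∈ L ∧ ∃ q ≤ N, MvPolynomial.IsHomogeneous p q}

section LowDegree

variable {R A ι κ : Type*} [CommRing R] [CommRing A]

theorem lowDegreePart_le (L : Ideal (MvPolynomial ι R)) (N : ℕ) : lowDegreePart L N ≤ L :=
  Ideal.span_le.2 fun _ h => h.1

theorem mem_lowDegreePart {L : Ideal (MvPolynomial ι R)} {N q : ℕ} {p : MvPolynomial ι R}
    (hp : p ∈ L) (hh : p.IsHomogeneous q) (hq : q ≤ N) : p ∈ lowDegreePart L N :=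
  Ideal.subset_span ⟨hp, q, hq, hh⟩

theorem map_mem_lowDegreePart {L : Ideal (MvPolynomial ι R)} {L' : Ideal (MvPolynomial κ A)}
    {N : ℕ} (ψ : MvPolynomial ι R →+* MvPolynomial κ A) (hψ : ∀ p ∈ L, ψ p ∈ L')
    (hhom : ∀ p q, p.IsHomogeneous q → (ψ p).IsHomogeneous q)
    {p : MvPolynomial ι R} (hp : p ∈ lowDegreePart L N) : ψ p ∈ lowDegreePart L' N := by
  refine (Ideal.span_le.2 ?_ : lowDegreePart L N ≤ (lowDegreePart L' N).comap ψ) hp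
  rintro x ⟨hx, q, hq, hh⟩
  exact mem_lowDegreePart (hψ x hx) (hhom x q hh) hq

theorem le_lowDegreePart_of_lift {L : Ideal (MvPolynomial ι R)}
    {L' : Ideal (MvPolynomial κ A)} {N : ℕ} (ψ : MvPolynomial ι R →+* MvPolynomial κ A)
    (hψ : ∀ p ∈ L, ψ p ∈ L') (hhom : ∀ p q, p.IsHomogeneous q → (ψ p).IsHomogeneous q)
    (hlift : ∀ p ∈ L', ∃ p' ∈ L, ψ p' = p) (hL : L ≤ lowDegreePart L N) :
    L' ≤ lowDegreePart L' N := by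
  intro p hp
  obtain ⟨p', hp', rfl⟩ := hlift p hp
  exact map_mem_lowDegreePart ψ hψ hhom (hL hp')

end LowDegree

section Independence

variable {R ι κ : Type*} [CommRing R]

theorem exists_linear_form {f : ι → R} {x : R} (hx : x ∈ Ideal.span (Set.range f)) :
    ∃ l : MvPolynomial ι R, l.IsHomogeneous 1 ∧
      MvPolynomial.aeval (fun i => Polynomial.C (f i) * (Polynomial.X : Polynomial R)) l =
        Polynomial.C x * Polynomial.X := by
  induction hx using Submodule.span_induction with
  | mem x h =>
    obtain ⟨i, rfl⟩ := h
    exact ⟨MvPolynomial.X i, MvPolynomial.isHomogeneous_X _ _, by simp⟩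
  | zero => exact ⟨0, MvPolynomial.isHomogeneous_zero _ _ _, by simp⟩
  | add x y _ _ hx hy =>
    obtain ⟨l, hl, hl'⟩ := hx
    obtain ⟨m, hm, hm'⟩ := hy
    exact ⟨l + m, hl.add hm, by simp [hl', hm', add_mul]⟩
  | smul a x _ hx =>
    obtain ⟨l, hl, hl'⟩ := hx
    refine ⟨MvPolynomial.C a * l, ?_, ?_⟩
    · simpa using (MvPolynomial.isHomogeneous_C _ a).mul hl
    · simp [hl', mul_assoc, Polynomial.algebraMap_eq]

theorem reesEquations_le_lowDegreePart_of_span_eq {f : ι → R} {g : κ → R}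
    (h : Ideal.span (Set.range f) = Ideal.span (Set.range g)) {N : ℕ} (hN : 1 ≤ N)
    (hf : reesEquations f ≤ lowDegreePart (reesEquations f) N) :
    reesEquations g ≤ lowDegreePart (reesEquations g) N := by
  have hg : ∀ j, g j ∈ Ideal.span (Set.range f) := fun j => h ▸ Ideal.subset_span ⟨j, rfl⟩
  have hf' : ∀ i, f i ∈ Ideal.span (Set.range g) := fun i => h ▸ Ideal.subset_span ⟨i, rfl⟩
  choose a ha ha' using fun j => exists_linear_form (hg j)
  choose b hb hb' using fun i => exists_linear_form (hf' i)
  let ψ : MvPolynomial κ R →ₐ[R] MvPolynomial ι R := MvPolynomial.aeval a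
  let θ : MvPolynomial ι R →ₐ[R] MvPolynomial κ R := MvPolynomial.aeval b
  have hθhom : ∀ p q, p.IsHomogeneous q → (θ p).IsHomogeneous q := fun p q hp => by
    simpa only [one_mul] using hp.aeval b hb
  have hψ : (MvPolynomial.aeval
      (fun i => Polynomial.C (f i) * (Polynomial.X : Polynomial R))).comp ψ =
      MvPolynomial.aeval (fun i => Polynomial.C (g i) * (Polynomial.X : Polynomial R)) :=
    MvPolynomial.algHom_ext fun j => by simp [ψ, ha']
  have hθ : (MvPolynomial.aeval
      (fun i => Polynomial.C (g i) * (Polynomial.X : Polynomial R))).comp θ =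
      MvPolynomial.aeval (fun i => Polynomial.C (f i) * (Polynomial.X : Polynomial R)) :=
    MvPolynomial.algHom_ext fun j => by simp [θ, hb']
  have hψmem : ∀ p ∈ reesEquations g, ψ p ∈ reesEquations f := fun p hp => by
    rw [reesEquations, RingHom.mem_ker] at hp ⊢
    rw [← hp, ← hψ]; rfl
  have hθmem : ∀ p ∈ reesEquations f, θ p ∈ reesEquations g := fun p hp => by
    rw [reesEquations, RingHom.mem_ker] at hp ⊢
    rw [← hp, ← hθ]; rfl
  have hmk : (Ideal.Quotient.mkₐ R (lowDegreePart (reesEquations g) N)).comp (θ.comp ψ) =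
      Ideal.Quotient.mkₐ R (lowDegreePart (reesEquations g) N) := by
    refine MvPolynomial.algHom_ext fun j => ?_
    have hj : (θ (ψ (MvPolynomial.X j))).IsHomogeneous 1 :=
      hθhom _ _ (by simpa [ψ] using ha j)
    refine Ideal.Quotient.eq.2 (mem_lowDegreePart ?_
      (hj.sub (MvPolynomial.isHomogeneous_X _ _)) hN)
    rw [reesEquations, RingHom.mem_ker, map_sub, sub_eq_zero]
    change ((MvPolynomial.aeval _).comp θ) (ψ _) = _
    rw [hθ, ← hψ]; rfl
  intro p hp
  have h1 : θ (ψ p) ∈ lowDegreePart (reesEquations g) N :=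
    map_mem_lowDegreePart θ.toRingHom hθmem hθhom (hf (hψmem p hp))
  have h2 : θ (ψ p) - p ∈ lowDegreePart (reesEquations g) N :=
    Ideal.Quotient.eq.1 (DFunLike.congr_fun hmk p)
  simpa using sub_mem h1 h2

theorem genInDegLE_reesKer_iff {s : ℕ} (f : Fin s → R) (N : ℕ) :
    GenInDegLE (reesKer f) N ↔ reesEquations f ≤ lowDegreePart (reesEquations f) N :=
  ⟨fun h => h.le, fun h => le_antisymm h (lowDegreePart_le _ N)⟩

theorem relType_eq_sInf {I : Ideal R} (hI : I.FG) {f : ι → R}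
    (hf : Ideal.span (Set.range f) = I) :
    relType I = sInf {N | 1 ≤ N ∧ reesEquations f ≤ lowDegreePart (reesEquations f) N} := by
  obtain ⟨s, g, hg⟩ := Submodule.fg_iff_exists_fin_generating_family.1 hI
  unfold relType
  congr 1
  ext N
  refine and_congr_right fun hN => ⟨fun h => ?_, fun h s' f' hf' => ?_⟩
  · exact reesEquations_le_lowDegreePart_of_span_eq (hg.trans hf.symm) hN
      ((genInDegLE_reesKer_iff g N).1 (h s g hg))
  · exact (genInDegLE_reesKer_iff f' N).2
      (reesEquations_le_lowDegreePart_of_span_eq (hf.trans hf'.symm) hN h)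

end Independence

section RingEquiv

variable {R A : Type*} [CommRing R] [CommRing A]

theorem map_mem_reesEquations {ι : Type*} (e : R →+* A) {f : ι → R} {g : ι → A}
    (hg : ∀ i, e (f i) = g i) {p : MvPolynomial ι R} (hp : p ∈ reesEquations f) :
    MvPolynomial.map e p ∈ reesEquations g := by
  rw [reesEquations, RingHom.mem_ker] at hp ⊢
  have : ((MvPolynomial.aeval (fun i => Polynomial.C (g i) *
      (Polynomial.X : Polynomial A))).toRingHom.comp (MvPolynomial.map e)) =
      (Polynomial.mapRingHom e).comp (MvPolynomial.aeval (fun i => Polynomial.C (f i) *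
      (Polynomial.X : Polynomial R))).toRingHom := by
    apply MvPolynomial.ringHom_ext <;> intro <;> simp [Polynomial.algebraMap_eq, hg]
  have h := DFunLike.congr_fun this p
  simp only [RingHom.comp_apply, AlgHom.toRingHom_eq_coe, RingHom.coe_coe, hp, map_zero] at h
  exact h

theorem reesEquations_le_lowDegreePart_of_ringEquiv {ι : Type*} (e : R ≃+* A) {f : ι → R}
    {g : ι → A} (hg : ∀ i, e (f i) = g i) {N : ℕ}
    (h : reesEquations f ≤ lowDegreePart (reesEquations f) N) :
    reesEquations g ≤ lowDegreePart (reesEquations g) N := by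
  refine le_lowDegreePart_of_lift (MvPolynomial.map (e : R →+* A))
    (fun p hp => map_mem_reesEquations _ hg hp) (fun p q hp => hp.map _) (fun p hp => ?_) h
  refine ⟨MvPolynomial.map (e.symm : A →+* R) p, map_mem_reesEquations _ (fun i => ?_) hp, ?_⟩
  · exact e.symm_apply_eq.2 (hg i).symm
  · rw [MvPolynomial.map_map, RingEquiv.comp_symm, MvPolynomial.map_id]

theorem relType_comap_ringEquiv [IsNoetherianRing R] (e : R ≃+* A) (J : Ideal A) :
    relType (J.comap (e : R →+* A)) = relType J := by
  have : IsNoetherianRing A := isNoetherianRing_of_ringEquiv R e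
  obtain ⟨s, f, hf⟩ := Submodule.fg_iff_exists_fin_generating_family.1
    (IsNoetherian.noetherian (J.comap (e : R →+* A)))
  have hJ : Ideal.span (Set.range fun i => e (f i)) = J := by
    have := congrArg (Ideal.map (e : R →+* A)) hf
    rw [Ideal.map_comap_of_surjective (e : R →+* A) e.surjective] at this
    rw [← this]
    change _ = Ideal.map _ (Ideal.span _)
    rw [Ideal.map_span, ← Set.range_comp]; rfl
  rw [relType_eq_sInf (IsNoetherian.noetherian _) hf,
    relType_eq_sInf (IsNoetherian.noetherian _) hJ]
  congr 1
  ext N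
  exact and_congr_right fun _ =>
    ⟨reesEquations_le_lowDegreePart_of_ringEquiv e fun _ => rfl,
      reesEquations_le_lowDegreePart_of_ringEquiv e.symm fun i => e.symm_apply_apply (f i)⟩

end RingEquiv

section AdjoinVariable

variable {R ι : Type*} [CommRing R]

/-- The family obtained from `f` by adjoining the variable of `R[z]`. -/
noncomputable def adjoinVariable (f : ι → R) : Option ι → Polynomial R :=
  fun o => o.elim Polynomial.X fun i => Polynomial.C (f i)

/-- The inclusion `R[t] → R[z][t, u]`. -/
noncomputable def inclusionHom (R ι : Type*) [CommRing R] :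
    MvPolynomial ι R →+* MvPolynomial (Option ι) (Polynomial R) :=
  MvPolynomial.eval₂Hom (MvPolynomial.C.comp Polynomial.C) fun i => MvPolynomial.X (some i)

/-- The retraction `R[z][t, u] → R[t]` sending `z` and `u` to zero. -/
noncomputable def retractionHom (R ι : Type*) [CommRing R] :
    MvPolynomial (Option ι) (Polynomial R) →+* MvPolynomial ι R :=
  MvPolynomial.eval₂Hom (MvPolynomial.C.comp (Polynomial.evalRingHom 0))
    fun o => o.elim 0 MvPolynomial.X

theorem retractionHom_inclusionHom (p : MvPolynomial ι R) :
    retractionHom R ι (inclusionHom R ι p) = p := by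
  have : (retractionHom R ι).comp (inclusionHom R ι) = RingHom.id _ := by
    apply MvPolynomial.ringHom_ext <;> intro <;> simp [retractionHom, inclusionHom]
  exact DFunLike.congr_fun this p

theorem isHomogeneous_retractionHom {p : MvPolynomial (Option ι) (Polynomial R)} {q : ℕ}
    (hp : p.IsHomogeneous q) : (retractionHom R ι p).IsHomogeneous q := by
  have := hp.eval₂ (n := 1) (MvPolynomial.C.comp (Polynomial.evalRingHom 0))
    (fun o => o.elim 0 MvPolynomial.X : Option ι → MvPolynomial ι R)
    (fun r => MvPolynomial.isHomogeneous_C _ _) (by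
      rintro (_ | i)
      · exact MvPolynomial.isHomogeneous_zero _ _ _
      · exact MvPolynomial.isHomogeneous_X _ _)
  rwa [one_mul] at this

theorem isHomogeneous_inclusionHom {p : MvPolynomial ι R} {q : ℕ}
    (hp : p.IsHomogeneous q) : (inclusionHom R ι p).IsHomogeneous q := by
  have := hp.eval₂ (n := 1) (MvPolynomial.C.comp Polynomial.C)
    (fun i => MvPolynomial.X (some i) : ι → MvPolynomial (Option ι) (Polynomial R))
    (fun r => MvPolynomial.isHomogeneous_C _ _) (fun i => MvPolynomial.isHomogeneous_X _ _)
  rwa [one_mul] at this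

theorem aeval_inclusionHom (f : ι → R) (p : MvPolynomial ι R) :
    MvPolynomial.aeval (fun o => Polynomial.C (adjoinVariable f o) *
      (Polynomial.X : Polynomial (Polynomial R))) (inclusionHom R ι p) =
      Polynomial.map Polynomial.C (MvPolynomial.aeval (fun i => Polynomial.C (f i) *
        (Polynomial.X : Polynomial R)) p) := by
  have : (MvPolynomial.aeval (fun o => Polynomial.C (adjoinVariable f o) *
      (Polynomial.X : Polynomial (Polynomial R)))).toRingHom.comp (inclusionHom R ι) =
      (Polynomial.mapRingHom Polynomial.C).comp (MvPolynomial.aeval (fun i =>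
        Polynomial.C (f i) * (Polynomial.X : Polynomial R))).toRingHom := by
    apply MvPolynomial.ringHom_ext <;> intro <;>
      simp [Polynomial.algebraMap_eq, inclusionHom, adjoinVariable]
  exact DFunLike.congr_fun this p

theorem aeval_retractionHom (f : ι → R) (p : MvPolynomial (Option ι) (Polynomial R)) :
    MvPolynomial.aeval (fun i => Polynomial.C (f i) * (Polynomial.X : Polynomial R))
      (retractionHom R ι p) =
      Polynomial.map (Polynomial.evalRingHom 0) (MvPolynomial.aeval (fun o =>
        Polynomial.C (adjoinVariable f o) * (Polynomial.X : Polynomial (Polynomial R))) p) := by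
  have : (MvPolynomial.aeval (fun i => Polynomial.C (f i) *
      (Polynomial.X : Polynomial R))).toRingHom.comp (retractionHom R ι) =
      (Polynomial.mapRingHom (Polynomial.evalRingHom 0)).comp (MvPolynomial.aeval (fun o =>
        Polynomial.C (adjoinVariable f o) *
          (Polynomial.X : Polynomial (Polynomial R)))).toRingHom := by
    apply MvPolynomial.ringHom_ext
    · intro; simp [Polynomial.algebraMap_eq, retractionHom]
    · rintro (_ | i) <;> simp [retractionHom, adjoinVariable]
  exact DFunLike.congr_fun this p

theorem inclusionHom_mem (f : ι → R) {p : MvPolynomial ι R} (hp : p ∈ reesEquations f) :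
    inclusionHom R ι p ∈ reesEquations (adjoinVariable f) := by
  rw [reesEquations, RingHom.mem_ker] at hp ⊢
  exact (aeval_inclusionHom f p).trans (by rw [hp, Polynomial.map_zero])

theorem reesEquations_le_of_adjoinVariable (f : ι → R) {N : ℕ}
    (h : reesEquations (adjoinVariable f) ≤
      lowDegreePart (reesEquations (adjoinVariable f)) N) :
    reesEquations f ≤ lowDegreePart (reesEquations f) N := by
  refine le_lowDegreePart_of_lift (retractionHom R ι) (fun p hp => ?_)
    (fun p q hp => isHomogeneous_retractionHom hp)
    (fun p hp => ⟨_, inclusionHom_mem f hp, retractionHom_inclusionHom p⟩) h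
  rw [reesEquations, RingHom.mem_ker] at hp ⊢
  exact (aeval_retractionHom f p).trans (by rw [hp, Polynomial.map_zero])

/-- The inclusion `R[t][u] → R[z][t, u]`. -/
noncomputable def inclusionTU (R ι : Type*) [CommRing R] :
    Polynomial (MvPolynomial ι R) →+* MvPolynomial (Option ι) (Polynomial R) :=
  Polynomial.eval₂RingHom (inclusionHom R ι) (MvPolynomial.X none)

/-- The inclusion `R[z][u] → R[z][t, u]`. -/
noncomputable def inclusionZU (R ι : Type*) [CommRing R] :
    Polynomial (Polynomial R) →+* MvPolynomial (Option ι) (Polynomial R) :=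
  Polynomial.eval₂RingHom MvPolynomial.C (MvPolynomial.X none)

theorem coeff_aeval_inclusionTU (f : ι → R) (c : Polynomial (MvPolynomial ι R)) (i j : ℕ) :
    ((MvPolynomial.aeval (fun o => Polynomial.C (adjoinVariable f o) *
      (Polynomial.X : Polynomial (Polynomial R))) (inclusionTU R ι c)).coeff j).coeff i =
      if i ≤ j then (MvPolynomial.aeval (fun i => Polynomial.C (f i) *
        (Polynomial.X : Polynomial R)) (c.coeff i)).coeff (j - i) else 0 := by
  induction c using Polynomial.induction_on' with
  | add p q hp hq =>
    simp only [map_add, Polynomial.coeff_add, hp, hq]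
    split_ifs <;> simp
  | monomial b a =>
    have h : MvPolynomial.aeval (fun o => Polynomial.C (adjoinVariable f o) *
        (Polynomial.X : Polynomial (Polynomial R)))
        (inclusionTU R ι (Polynomial.monomial b a)) =
        Polynomial.map Polynomial.C (MvPolynomial.aeval (fun i => Polynomial.C (f i) *
          (Polynomial.X : Polynomial R)) a) * Polynomial.C (Polynomial.X ^ b) *
          Polynomial.X ^ b := by
      simp only [inclusionTU, Polynomial.coe_eval₂RingHom, Polynomial.eval₂_monomial, map_mul,
        map_pow, aeval_inclusionHom, MvPolynomial.aeval_X]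
      simp [adjoinVariable, mul_pow, mul_assoc]
    rw [h, Polynomial.coeff_mul_X_pow', Polynomial.coeff_monomial]
    rw [Polynomial.coeff_mul_C, Polynomial.coeff_map, apply_ite (Polynomial.coeff · i),
      Polynomial.coeff_C_mul, Polynomial.coeff_X_pow]
    by_cases hb : b = i
    · subst hb
      simp
    · simp [hb, Ne.symm hb]

theorem coeff_aeval_inclusionZU (f : ι → R) (d : Polynomial (Polynomial R)) (i j : ℕ) :
    ((MvPolynomial.aeval (fun o => Polynomial.C (adjoinVariable f o) *
      (Polynomial.X : Polynomial (Polynomial R))) (inclusionZU R ι d)).coeff j).coeff i =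
      if j ≤ i then (d.coeff j).coeff (i - j) else 0 := by
  induction d using Polynomial.induction_on' with
  | add p q hp hq =>
    simp only [map_add, Polynomial.coeff_add, hp, hq]
    split_ifs <;> simp
  | monomial b a =>
    have h : MvPolynomial.aeval (fun o => Polynomial.C (adjoinVariable f o) *
        (Polynomial.X : Polynomial (Polynomial R)))
        (inclusionZU R ι (Polynomial.monomial b a)) =
        Polynomial.C (a * Polynomial.X ^ b) * Polynomial.X ^ b := by
      simp [inclusionZU, adjoinVariable, mul_pow, mul_assoc, Polynomial.algebraMap_eq]
    rw [h, Polynomial.coeff_C_mul_X_pow, Polynomial.coeff_monomial]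
    by_cases hb : b = j
    · subst hb
      simp [Polynomial.coeff_mul_X_pow']
    · simp [hb, Ne.symm hb]

theorem sum_inclusion_mem_lowDegreePart (f : ι → R) {N : ℕ}
    (h : reesEquations f ≤ lowDegreePart (reesEquations f) N)
    (c : Polynomial (MvPolynomial ι R)) (d : Polynomial (Polynomial R))
    (hcd : inclusionTU R ι c + inclusionZU R ι d ∈ reesEquations (adjoinVariable f)) :
    inclusionTU R ι c + inclusionZU R ι d ∈
      lowDegreePart (reesEquations (adjoinVariable f)) N := by
  have key : ∀ (c : Polynomial (MvPolynomial ι R)) (d : Polynomial (Polynomial R)),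
      inclusionTU R ι c + inclusionZU R ι d ∈ reesEquations (adjoinVariable f) → ∀ i j,
      (if i ≤ j then (MvPolynomial.aeval (fun i => Polynomial.C (f i) *
        (Polynomial.X : Polynomial R)) (c.coeff i)).coeff (j - i) else 0) +
      (if j ≤ i then (d.coeff j).coeff (i - j) else 0) = 0 := by
    intro c d hcd i j
    rw [reesEquations, RingHom.mem_ker] at hcd
    rw [← coeff_aeval_inclusionTU, ← coeff_aeval_inclusionZU f, ← Polynomial.coeff_add,
      ← Polynomial.coeff_add, ← map_add]
    exact congrArg (fun p : Polynomial (Polynomial R) => (p.coeff j).coeff i) hcd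
  have hd : d = Polynomial.map Polynomial.C (Polynomial.map (Polynomial.evalRingHom 0) d) := by
    ext j a
    rcases Nat.eq_zero_or_pos a with rfl | ha
    · simp [Polynomial.coeff_zero_eq_eval_zero]
    · have := key c d hcd (j + a) j
      rw [if_neg (by omega), if_pos (by omega), zero_add, Nat.add_sub_cancel_left] at this
      rw [this, Polynomial.coeff_map, Polynomial.coeff_C_of_ne_zero ha.ne']
  generalize Polynomial.map (Polynomial.evalRingHom 0) d = e at hd
  subst hd
  have he : inclusionZU R ι (Polynomial.map Polynomial.C e) =
      inclusionTU R ι (Polynomial.map MvPolynomial.C e) := by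
    simp [inclusionZU, inclusionTU, Polynomial.eval₂_map, inclusionHom,
      MvPolynomial.eval₂Hom_comp_C]
  have hmem : ∀ c : Polynomial (MvPolynomial ι R),
      inclusionTU R ι c ∈ reesEquations (adjoinVariable f) →
      inclusionTU R ι c ∈ lowDegreePart (reesEquations (adjoinVariable f)) N := by
    intro c hc
    have hcoeff : ∀ b, c.coeff b ∈ reesEquations f := by
      intro b
      rw [reesEquations, RingHom.mem_ker]
      ext a
      have := key c 0 (by simpa using hc) b (b + a)
      simpa using this
    rw [inclusionTU, Polynomial.coe_eval₂RingHom, Polynomial.eval₂_eq_sum, Polynomial.sum]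
    exact Ideal.sum_mem _ fun b _ => Ideal.mul_mem_right _ _ <|
      map_mem_lowDegreePart (inclusionHom R ι) (fun _ hp => inclusionHom_mem f hp)
        (fun _ _ hp => isHomogeneous_inclusionHom hp) (h (hcoeff b))
  rw [he, ← map_add] at hcd ⊢
  exact hmem _ hcd

theorem linear_relation_mem_lowDegreePart (f : ι → R) {N : ℕ} (hN : 1 ≤ N) (i : ι) :
    MvPolynomial.C Polynomial.X * MvPolynomial.X (some i) -
      MvPolynomial.C (Polynomial.C (f i)) * MvPolynomial.X none ∈
      lowDegreePart (reesEquations (adjoinVariable f)) N := by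
  refine mem_lowDegreePart (q := 1) ?_ ?_ hN
  · rw [reesEquations, RingHom.mem_ker]
    simp [adjoinVariable, Polynomial.algebraMap_eq]
    ring
  · refine MvPolynomial.IsHomogeneous.sub ?_ ?_
    · simpa using (MvPolynomial.isHomogeneous_C (Option ι) (Polynomial.X : Polynomial R)).mul
        (MvPolynomial.isHomogeneous_X _ (some i))
    · simpa using (MvPolynomial.isHomogeneous_C (Option ι) (Polynomial.C (f i))).mul
        (MvPolynomial.isHomogeneous_X _ none)

theorem exists_inclusion_add_sub_mem {f : ι → R}
    {J : Ideal (MvPolynomial (Option ι) (Polynomial R))}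
    (hJ : ∀ i, MvPolynomial.C Polynomial.X * MvPolynomial.X (some i) -
      MvPolynomial.C (Polynomial.C (f i)) * MvPolynomial.X none ∈ J)
    (p : MvPolynomial (Option ι) (Polynomial R)) :
    ∃ c d, p - (inclusionTU R ι c + inclusionZU R ι d) ∈ J := by
  have hadd : ∀ p q, (∃ c d, p - (inclusionTU R ι c + inclusionZU R ι d) ∈ J) →
      (∃ c d, q - (inclusionTU R ι c + inclusionZU R ι d) ∈ J) →
      ∃ c d, p + q - (inclusionTU R ι c + inclusionZU R ι d) ∈ J := by
    rintro p q ⟨c, d, h⟩ ⟨c', d', h'⟩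
    refine ⟨c + c', d + d', ?_⟩
    convert add_mem h h' using 1
    simp only [map_add]; ring
  have hZU : ∀ (d : Polynomial (Polynomial R)) (i : ι), ∃ c' d',
      inclusionZU R ι d * MvPolynomial.X (some i) -
        (inclusionTU R ι c' + inclusionZU R ι d') ∈ J := by
    intro d i
    induction d using Polynomial.induction_on' with
    | add p q hp hq => rw [map_add, add_mul]; exact hadd _ _ hp hq
    | monomial b a =>
      induction a using Polynomial.induction_on' with
      | add p q hp hq => rw [map_add, map_add, add_mul]; exact hadd _ _ hp hq
      | monomial m r =>
        cases m with
        | zero =>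
          refine ⟨Polynomial.monomial b (MvPolynomial.C r * MvPolynomial.X i), 0, ?_⟩
          convert J.zero_mem using 1
          simp [inclusionZU, inclusionTU, inclusionHom]
          ring
        | succ m =>
          refine ⟨0, Polynomial.monomial (b + 1) (Polynomial.monomial m (r * f i)), ?_⟩
          convert J.mul_mem_left (MvPolynomial.C (Polynomial.monomial m r) *
            MvPolynomial.X none ^ b) (hJ i) using 1
          simp only [inclusionZU, Polynomial.coe_eval₂RingHom, Polynomial.eval₂_monomial,
            map_zero, zero_add]
          simp only [← Polynomial.C_mul_X_pow_eq_monomial, map_mul, map_pow]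
          ring
  induction p using MvPolynomial.induction_on with
  | C a => exact ⟨0, Polynomial.C a, by simp [inclusionZU]⟩
  | add p q hp hq => exact hadd _ _ hp hq
  | mul_X p o hp =>
    obtain ⟨c, d, h⟩ := hp
    cases o with
    | none =>
      refine ⟨c * Polynomial.X, d * Polynomial.X, ?_⟩
      convert J.mul_mem_right (MvPolynomial.X none) h using 1
      simp [inclusionTU, inclusionZU]
      ring
    | some i =>
      obtain ⟨c', d', h'⟩ := hZU d i
      refine ⟨c * Polynomial.C (MvPolynomial.X i) + c', d', ?_⟩
      convert add_mem (J.mul_mem_right (MvPolynomial.X (some i)) h) h' using 1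
      have : inclusionTU R ι (Polynomial.C (MvPolynomial.X i)) = MvPolynomial.X (some i) := by
        simp [inclusionTU, inclusionHom]
      rw [map_add, map_mul, this]
      ring

theorem adjoinVariable_reesEquations_le (f : ι → R) {N : ℕ} (hN : 1 ≤ N)
    (h : reesEquations f ≤ lowDegreePart (reesEquations f) N) :
    reesEquations (adjoinVariable f) ≤
      lowDegreePart (reesEquations (adjoinVariable f)) N := by
  intro p hp
  obtain ⟨c, d, hcd⟩ :=
    exists_inclusion_add_sub_mem (linear_relation_mem_lowDegreePart f hN) p
  have hmem : inclusionTU R ι c + inclusionZU R ι d ∈ reesEquations (adjoinVariable f) := by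
    simpa using sub_mem hp (lowDegreePart_le _ _ hcd)
  simpa using add_mem hcd (sum_inclusion_mem_lowDegreePart f h c d hmem)

theorem span_range_adjoinVariable (f : ι → R) :
    Ideal.span (Set.range (adjoinVariable f)) =
      (Ideal.span (Set.range f)).comap (Polynomial.evalRingHom 0) := by
  apply le_antisymm
  · rw [Ideal.span_le]
    rintro _ ⟨_ | i, rfl⟩
    · simp [adjoinVariable]
    · simpa [adjoinVariable] using Ideal.subset_span (Set.mem_range_self i)
  · intro p hp
    have hX : (Polynomial.X : Polynomial R) ∈ Ideal.span (Set.range (adjoinVariable f)) :=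
      Ideal.subset_span ⟨none, rfl⟩
    have hC : Ideal.span (Set.range f) ≤
        (Ideal.span (Set.range (adjoinVariable f))).comap Polynomial.C :=
      Ideal.span_le.2 (by rintro _ ⟨i, rfl⟩; exact Ideal.subset_span ⟨some i, rfl⟩)
    rw [← Polynomial.divX_mul_X_add p]
    refine add_mem (Ideal.mul_mem_left _ _ hX) (hC ?_)
    rwa [Polynomial.coeff_zero_eq_eval_zero]

theorem relType_comap_eval_zero [IsNoetherianRing R] (I : Ideal R) :
    relType (I.comap (Polynomial.evalRingHom 0)) = relType I := by
  obtain ⟨s, f, hf⟩ := Submodule.fg_iff_exists_fin_generating_family.1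
    (IsNoetherian.noetherian I)
  have hf' : Ideal.span (Set.range f) = I := hf
  rw [relType_eq_sInf (IsNoetherian.noetherian _) hf',
    relType_eq_sInf (IsNoetherian.noetherian _)
      ((span_range_adjoinVariable f).trans (by rw [hf']))]
  congr 1
  ext N
  exact and_congr_right fun hN =>
    ⟨reesEquations_le_of_adjoinVariable f, adjoinVariable_reesEquations_le f hN⟩

theorem relType_comap_eval [IsNoetherianRing R] (a : R) (I : Ideal R) :
    relType (I.comap (Polynomial.evalRingHom a)) = relType I := by
  rw [← relType_comap_eval_zero I, ← relType_comap_ringEquiv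
    (Polynomial.algEquivAevalXAddC a).toRingEquiv (I.comap (Polynomial.evalRingHom 0)),
    Ideal.comap_comap]
  congr 2
  ext <;> simp

theorem relType_comap_aeval [IsNoetherianRing R] {r : ℕ} (g : Fin r → R) (I : Ideal R) :
    relType (I.comap (MvPolynomial.aeval g : MvPolynomial (Fin r) R →ₐ[R] R)) = relType I := by
  induction r with
  | zero =>
    rw [← relType_comap_ringEquiv (MvPolynomial.isEmptyAlgEquiv R (Fin 0)).toRingEquiv I]
    congr 1
    ext p
    rw [Ideal.mem_comap, Ideal.mem_comap]
    obtain ⟨a, rfl⟩ := MvPolynomial.C_surjective (Fin 0) p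
    have ha : MvPolynomial.isEmptyAlgEquiv R (Fin 0) (MvPolynomial.C a) = a :=
      (MvPolynomial.isEmptyAlgEquiv R (Fin 0)).commutes a
    simp [-MvPolynomial.isEmptyAlgEquiv_apply, ha]
  | succ r ih =>
    have hcomp : (MvPolynomial.aeval g : MvPolynomial (Fin (r + 1)) R →ₐ[R] R).toRingHom =
        ((MvPolynomial.aeval (fun i => g i.succ) :
          MvPolynomial (Fin r) R →ₐ[R] R).toRingHom.comp
          (Polynomial.evalRingHom (MvPolynomial.C (g 0)))).comp
          ((MvPolynomial.finSuccEquiv R r).toRingEquiv :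
            MvPolynomial (Fin (r + 1)) R →+* Polynomial (MvPolynomial (Fin r) R)) := by
      apply MvPolynomial.ringHom_ext
      · intro a; simp [MvPolynomial.finSuccEquiv_apply]
      · intro i
        refine Fin.cases ?_ (fun i => ?_) i
        · simp [MvPolynomial.finSuccEquiv_X_zero]
        · simp [MvPolynomial.finSuccEquiv_X_succ]
    have h : I.comap (MvPolynomial.aeval g : MvPolynomial (Fin (r + 1)) R →ₐ[R] R) =
        I.comap (MvPolynomial.aeval g : MvPolynomial (Fin (r + 1)) R →ₐ[R] R).toRingHom := rfl
    rw [h, hcomp, ← Ideal.comap_comap, ← Ideal.comap_comap, relType_comap_ringEquiv,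
      relType_comap_eval]
    exact ih _

end AdjoinVariable

section Trinomial

variable {k : Type*} [Field k] {n r : ℕ}

/-- The number of monomial terms of a polynomial, in all variables. -/
noncomputable def termCount (p : MvPolynomial (Fin r) (MvPolynomial (Fin n) k)) : ℕ :=
  ∑ α ∈ p.support, (p.coeff α).support.card

theorem termCount_eq_sum {p : MvPolynomial (Fin r) (MvPolynomial (Fin n) k)}
    {s : Finset (Fin r →₀ ℕ)} (hs : p.support ⊆ s) :
    termCount p = ∑ α ∈ s, (p.coeff α).support.card := by
  refine Finset.sum_subset hs fun α _ hα => ?_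
  simp [MvPolynomial.notMem_support_iff.1 hα]

theorem termCount_add_le (p q : MvPolynomial (Fin r) (MvPolynomial (Fin n) k)) :
    termCount (p + q) ≤ termCount p + termCount q := by
  classical
  rw [termCount_eq_sum (MvPolynomial.support_add (p := p) (q := q)),
    termCount_eq_sum (Finset.subset_union_left (s₁ := p.support) (s₂ := q.support)),
    termCount_eq_sum (Finset.subset_union_right (s₁ := p.support) (s₂ := q.support)),
    ← Finset.sum_add_distrib]
  refine Finset.sum_le_sum fun α _ => ?_
  rw [MvPolynomial.coeff_add]
  exact (Finset.card_le_card MvPolynomial.support_add).trans (Finset.card_union_le _ _)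

theorem termCount_neg (p : MvPolynomial (Fin r) (MvPolynomial (Fin n) k)) :
    termCount (-p) = termCount p := by
  simp [termCount, MvPolynomial.support_neg]

theorem termCount_sub_le (p q : MvPolynomial (Fin r) (MvPolynomial (Fin n) k)) :
    termCount (p - q) ≤ termCount p + termCount q := by
  rw [sub_eq_add_neg, ← termCount_neg q]
  exact termCount_add_le _ _

theorem termCount_monomial_le (α : Fin r →₀ ℕ) (β : Fin n →₀ ℕ) (c : k) :
    termCount (MvPolynomial.monomial α (MvPolynomial.monomial β c)) ≤ 1 := by
  classical
  rw [termCount_eq_sum MvPolynomial.support_monomial_subset]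
  simpa using Finset.card_le_card (MvPolynomial.support_monomial_subset (s := β) (a := c))

theorem termCount_X_le (i : Fin r) :
    termCount (MvPolynomial.X i : MvPolynomial (Fin r) (MvPolynomial (Fin n) k)) ≤ 1 :=
  termCount_monomial_le _ 0 1

theorem termCount_C_monomial_le (β : Fin n →₀ ℕ) (c : k) :
    termCount (MvPolynomial.C (MvPolynomial.monomial β c) :
      MvPolynomial (Fin r) (MvPolynomial (Fin n) k)) ≤ 1 :=
  termCount_monomial_le 0 β c

theorem comap_aeval_le {R : Type*} [CommRing R] {g : Fin r → R} {I : Ideal R}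
    {J : Ideal (MvPolynomial (Fin r) R)} (hX : ∀ i, MvPolynomial.X i - MvPolynomial.C (g i) ∈ J)
    (hC : ∀ a ∈ I, MvPolynomial.C a ∈ J) :
    I.comap (MvPolynomial.aeval g : MvPolynomial (Fin r) R →ₐ[R] R) ≤ J := by
  have hmk : (Ideal.Quotient.mkₐ R J).comp
      ((Algebra.ofId R (MvPolynomial (Fin r) R)).comp (MvPolynomial.aeval g)) =
      Ideal.Quotient.mkₐ R J :=
    MvPolynomial.algHom_ext fun i => by
      refine Ideal.Quotient.eq.2 ?_
      rw [← neg_mem_iff, neg_sub]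
      simpa [Algebra.ofId_apply, MvPolynomial.algebraMap_eq] using hX i
  intro p hp
  have h : MvPolynomial.C (MvPolynomial.aeval g p) - p ∈ J :=
    Ideal.Quotient.eq.1 (DFunLike.congr_fun hmk p)
  simpa using sub_mem (hC _ hp) h

theorem exists_comap_eq_span_trinomials (I : Ideal (MvPolynomial (Fin n) k)) :
    ∃ (r : ℕ) (g : Fin r → MvPolynomial (Fin n) k)
      (T : Set (MvPolynomial (Fin r) (MvPolynomial (Fin n) k))), (∀ p ∈ T, IsTrinomial p) ∧
      I.comap (MvPolynomial.aeval g : MvPolynomial (Fin r) (MvPolynomial (Fin n) k)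
        →ₐ[MvPolynomial (Fin n) k] MvPolynomial (Fin n) k) = Ideal.span T := by
  classical
  obtain ⟨s, f, hf⟩ := Submodule.fg_iff_exists_fin_generating_family.1
    (IsNoetherian.noetherian I)
  replace hf : Ideal.span (Set.range f) = I := hf
  let partialSum : (i : Fin s) × Finset (f i).support → MvPolynomial (Fin n) k :=
    fun x => ∑ d ∈ x.2, MvPolynomial.monomial d.1 ((f x.1).coeff d.1)
  let e := Fintype.equivFin ((i : Fin s) × Finset (f i).support)
  let g := fun j => partialSum (e.symm j)
  have hg : ∀ x, g (e x) = partialSum x := fun x => congrArg partialSum (e.symm_apply_apply x)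
  let σ : MvPolynomial (Fin _) (MvPolynomial (Fin n) k) →ₐ[MvPolynomial (Fin n) k]
    MvPolynomial (Fin n) k := MvPolynomial.aeval g
  let T := {p | p ∈ I.comap σ ∧ IsTrinomial p}
  refine ⟨_, g, T, fun p hp => hp.2, le_antisymm ?_ (Ideal.span_le.2 fun p hp => hp.1)⟩
  have hfull : ∀ i, partialSum ⟨i, Finset.univ⟩ = f i := fun i => by
    conv_rhs => rw [MvPolynomial.as_sum (f i), ← Finset.sum_coe_sort]
  have hX : ∀ x, MvPolynomial.X (e x) - MvPolynomial.C (partialSum x) ∈ Ideal.span T := by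
    rintro ⟨i, D⟩
    induction D using Finset.induction_on with
    | empty =>
      have h0 : partialSum ⟨i, ∅⟩ = 0 := Finset.sum_empty
      rw [h0, map_zero, sub_zero]
      refine Ideal.subset_span ⟨?_, (termCount_X_le _).trans (by norm_num)⟩
      simp [σ, Ideal.mem_comap, hg, h0]
    | insert d D hd ih =>
      have hs : partialSum ⟨i, insert d D⟩ =
          MvPolynomial.monomial d.1 ((f i).coeff d.1) + partialSum ⟨i, D⟩ :=
        Finset.sum_insert hd
      have hT : MvPolynomial.X (e ⟨i, insert d D⟩) - MvPolynomial.X (e ⟨i, D⟩) -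
          MvPolynomial.C (MvPolynomial.monomial d.1 ((f i).coeff d.1)) ∈ Ideal.span T := by
        refine Ideal.subset_span ⟨?_, ?_⟩
        · simp [σ, Ideal.mem_comap, hg, hs]
        · exact (termCount_sub_le _ _).trans (add_le_add ((termCount_sub_le _ _).trans
            (add_le_add (termCount_X_le _) (termCount_X_le _))) (termCount_C_monomial_le _ _))
      convert add_mem hT ih using 1
      rw [hs, map_add]; ring
  refine comap_aeval_le (fun j => ?_) (fun a ha => ?_)
  · simpa [g] using hX (e.symm j)
  · rw [← hf] at ha
    refine (Ideal.span_le.2 ?_ : Ideal.span (Set.range f) ≤ (Ideal.span T).comap MvPolynomial.C) ha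
    rintro _ ⟨i, rfl⟩
    have hT : (MvPolynomial.X (e ⟨i, Finset.univ⟩) :
        MvPolynomial (Fin _) (MvPolynomial (Fin n) k)) ∈ Ideal.span T := by
      refine Ideal.subset_span ⟨?_, (termCount_X_le _).trans (by norm_num)⟩
      have hi : f i ∈ Ideal.span (Set.range f) := Ideal.subset_span (Set.mem_range_self i)
      rwa [Ideal.mem_comap, MvPolynomial.aeval_X, hg, hfull, ← hf]
    have := sub_mem hT (hX ⟨i, Finset.univ⟩)
    rwa [hfull, sub_sub_cancel] at this

end Trinomial

/-- **Proposition (reduction to trinomials).** For any ideal `I` of `R = k[x₁,…,xₙ]` there are a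
polynomial ring `S = R[y₁,…,y_r]` and a surjective `R`-algebra map `σ : S → R` such that
`σ⁻¹(I)` is generated by trinomials and `rt(I) = rt(σ⁻¹(I))`. -/
theorem relType_reduction_to_trinomials {k : Type*} [Field k] {n : ℕ}
    (I : Ideal (MvPolynomial (Fin n) k)) :
    ∃ (r : ℕ)
      (σ : MvPolynomial (Fin r) (MvPolynomial (Fin n) k) →ₐ[MvPolynomial (Fin n) k]
        MvPolynomial (Fin n) k),
      Function.Surjective σ ∧
      (∃ T : Set (MvPolynomial (Fin r) (MvPolynomial (Fin n) k)),
        (∀ p ∈ T, IsTrinomial p) ∧ Ideal.comap σ I = Ideal.span T) ∧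
      relType I = relType (Ideal.comap σ I) := by
  obtain ⟨r, g, T, hT, hspan⟩ := exists_comap_eq_span_trinomials I
  exact ⟨r, MvPolynomial.aeval g, fun a => ⟨MvPolynomial.C a, by simp⟩, ⟨T, hT, hspan⟩,
    (relType_comap_aeval g I).symm⟩
end

section
/- Let k be a field, p ≥ 1 an integer, and I = (x^p, y^p, x^{p−1}y) an ideal of R = k[x,y]. Then rt(I) = p. -/
open Polynomial MvPolynomial

section ReesKernel

variable {R : Type*} [CommRing R] {s r : ℕ}

theorem mem_reesKer {f : Fin s → R} {P : MvPolynomial (Fin s) R} :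
    P ∈ reesKer f ↔
      MvPolynomial.aeval (fun i => Polynomial.C (f i) * Polynomial.X) P = 0 :=
  Iff.rfl

/-- The linear change of variables `Tᵢ ↦ ∑ⱼ aᵢⱼ Uⱼ`. -/
noncomputable def linearSubst (a : Fin s → Fin r → R) :
    MvPolynomial (Fin s) R →ₐ[R] MvPolynomial (Fin r) R :=
  MvPolynomial.aeval (fun i => ∑ j, MvPolynomial.C (a i j) * MvPolynomial.X j)

theorem isHomogeneous_sum_C_mul_X (b : Fin r → R) :
    (∑ j, MvPolynomial.C (b j) * MvPolynomial.X j : MvPolynomial (Fin r) R).IsHomogeneous 1 :=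
  MvPolynomial.IsHomogeneous.sum _ _ _ fun j _ => by
    simpa using (MvPolynomial.isHomogeneous_C (Fin r) (b j)).mul (MvPolynomial.isHomogeneous_X R j)

theorem MvPolynomial.IsHomogeneous.linearSubst {P : MvPolynomial (Fin s) R} {q : ℕ}
    (hP : P.IsHomogeneous q) (a : Fin s → Fin r → R) : (linearSubst a P).IsHomogeneous q := by
  have h := hP.aeval (fun i => ∑ j, MvPolynomial.C (a i j) * MvPolynomial.X j)
    (fun i => isHomogeneous_sum_C_mul_X (a i))
  rwa [one_mul] at h

theorem aeval_linearSubst {f : Fin s → R} {g : Fin r → R} {a : Fin s → Fin r → R}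
    (h : ∀ i, ∑ j, a i j * g j = f i) (P : MvPolynomial (Fin s) R) :
    MvPolynomial.aeval (fun j => Polynomial.C (g j) * Polynomial.X) (linearSubst a P) =
      MvPolynomial.aeval (fun i => Polynomial.C (f i) * Polynomial.X) P := by
  unfold linearSubst
  rw [← AlgHom.comp_apply]
  congr 1
  ext1 i
  simp only [AlgHom.comp_apply, MvPolynomial.aeval_X, map_sum, map_mul, ← h i,
    Finset.sum_mul, MvPolynomial.algHom_C, Polynomial.algebraMap_apply, mul_assoc,
    Algebra.algebraMap_self, RingHom.id_apply]

theorem sub_aeval_mem {S : Type*} [CommRing S] {σ : Type*} {J : Ideal (MvPolynomial σ S)}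
    {v : σ → MvPolynomial σ S} (h : ∀ i, MvPolynomial.X i - v i ∈ J) (P : MvPolynomial σ S) :
    P - MvPolynomial.aeval v P ∈ J := by
  rw [← Ideal.Quotient.mk_eq_mk_iff_sub_mem]
  have : Ideal.Quotient.mkₐ S J =
      (Ideal.Quotient.mkₐ S J).comp (MvPolynomial.aeval v) := by
    ext1 i
    simpa using (Ideal.Quotient.mk_eq_mk_iff_sub_mem _ _).2 (h i)
  exact DFunLike.congr_fun this P

/-- Being generated in degree at most `N ≥ 1` does not depend on the generating family. -/
theorem GenInDegLE.of_span_eq {f : Fin s → R} {g : Fin r → R} {N : ℕ} (hN : 1 ≤ N)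
    (hspan : Ideal.span (Set.range f) = Ideal.span (Set.range g))
    (hg : GenInDegLE (reesKer g) N) : GenInDegLE (reesKer f) N := by
  have hfg (i) : ∃ c : Fin r → R, ∑ j, c j * g j = f i :=
    Ideal.mem_span_range_iff_exists_fun.1 (hspan ▸ Ideal.subset_span ⟨i, rfl⟩)
  have hgf (j) : ∃ c : Fin s → R, ∑ i, c i * f i = g j :=
    Ideal.mem_span_range_iff_exists_fun.1 (hspan.symm ▸ Ideal.subset_span ⟨j, rfl⟩)
  choose a ha using hfg
  choose b hb using hgf
  refine le_antisymm (fun P hP => ?_) (Ideal.span_le.2 fun P hP => hP.1)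
  set J := Ideal.span {p | p ∈ reesKer f ∧ ∃ q ≤ N, MvPolynomial.IsHomogeneous p q}
  have hdiff : P - linearSubst b (linearSubst a P) ∈ J := by
    have hcomp : (linearSubst b).comp (linearSubst a) = MvPolynomial.aeval
        (fun i => linearSubst b (linearSubst a (MvPolynomial.X i))) := by
      ext1 i; simp
    rw [← AlgHom.comp_apply, hcomp]
    refine sub_aeval_mem (fun i => ?_) P
    refine Ideal.subset_span ⟨?_, 1, hN, ?_⟩
    · rw [mem_reesKer, map_sub, aeval_linearSubst hb, aeval_linearSubst ha, sub_self]
    · exact (MvPolynomial.isHomogeneous_X R i).sub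
        (((MvPolynomial.isHomogeneous_X R i).linearSubst a).linearSubst b)
  have hmem : linearSubst a P ∈ J.comap (linearSubst b) := by
    have h1 : linearSubst a P ∈ reesKer g := by
      rw [mem_reesKer, aeval_linearSubst ha]; exact hP
    rw [hg] at h1
    refine Ideal.span_le.2 ?_ h1
    rintro Q ⟨hQ, q, hq, hQh⟩
    refine Ideal.subset_span ⟨?_, q, hq, hQh.linearSubst b⟩
    rw [mem_reesKer, aeval_linearSubst hb]; exact hQ
  simpa using J.add_mem hdiff hmem

end ReesKernel

section MonomialIdeal

variable (k : Type*) [Field k] (p : ℕ)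

/-- The generators `x^p, y^p, x^{p-1}y`. -/
noncomputable def monomialGens : Fin 3 → MvPolynomial (Fin 2) k :=
  ![MvPolynomial.X 0 ^ p, MvPolynomial.X 1 ^ p, MvPolynomial.X 0 ^ (p - 1) * MvPolynomial.X 1]

theorem span_range_monomialGens :
    Ideal.span (Set.range (monomialGens k p)) =
      Ideal.span {(MvPolynomial.X 0 : MvPolynomial (Fin 2) k) ^ p, MvPolynomial.X 1 ^ p,
        MvPolynomial.X 0 ^ (p - 1) * MvPolynomial.X 1} := by
  congr 1
  ext z
  simp [monomialGens]
  tauto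

/-- The monomial `x^a y^b T₀^c T₁^d T₂^e`. -/
noncomputable def biMonomial (a b c d e : ℕ) :
    MvPolynomial (Fin 3) (MvPolynomial (Fin 2) k) :=
  MvPolynomial.C (MvPolynomial.X 0 ^ a * MvPolynomial.X 1 ^ b) *
    (MvPolynomial.X 0 ^ c * MvPolynomial.X 1 ^ d * MvPolynomial.X 2 ^ e)

variable {k}

theorem biMonomial_isHomogeneous (a b c d e : ℕ) :
    (biMonomial k a b c d e).IsHomogeneous (c + d + e) := by
  have h := (MvPolynomial.isHomogeneous_C (Fin 3)
    (MvPolynomial.X 0 ^ a * MvPolynomial.X 1 ^ b : MvPolynomial (Fin 2) k)).mul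
    (((MvPolynomial.isHomogeneous_X_pow 0 c).mul (MvPolynomial.isHomogeneous_X_pow 1 d)).mul
      (MvPolynomial.isHomogeneous_X_pow 2 e))
  rwa [zero_add] at h

theorem biMonomial_mul (a b c d e a' b' c' d' e' : ℕ) :
    biMonomial k a b c d e * biMonomial k a' b' c' d' e' =
      biMonomial k (a + a') (b + b') (c + c') (d + d') (e + e') := by
  simp only [biMonomial, map_mul, map_pow]
  ring

theorem aeval_biMonomial (a b c d e : ℕ) :
    MvPolynomial.aeval (fun i => Polynomial.C (monomialGens k p i) * Polynomial.X)
      (biMonomial k a b c d e) =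
      Polynomial.C (MvPolynomial.X 0 ^ (a + p * c + (p - 1) * e) *
        MvPolynomial.X 1 ^ (b + p * d + e)) * Polynomial.X ^ (c + d + e) := by
  simp only [biMonomial, monomialGens, map_mul, map_pow, MvPolynomial.aeval_X,
    MvPolynomial.algHom_C, Polynomial.algebraMap_apply, Algebra.algebraMap_self, RingHom.id_apply,
    Matrix.cons_val_zero, Matrix.cons_val_one, Matrix.cons_val, mul_pow, ← pow_mul]
  ring

variable {p}

/-- Monomials whose exponents admit no reduction by `yT₀ - xT₂` or by
`y^{p-i}T₂^i - x^{p-i}T₀^{i-1}T₁`. -/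
structure IsReducedExp (p b c e : ℕ) : Prop where
  left : b = 0 ∨ c = 0
  right : e = 0 ∨ b + e < p

theorem IsReducedExp.le_of_weight_eq (hp : 1 ≤ p) {b c d e b' c' d' e' : ℕ}
    (h : IsReducedExp p b c e) (hy : b + p * d + e = b' + p * d' + e')
    (hT : c + d + e = c' + d' + e') : d' ≤ d := by
  by_contra! hlt
  obtain ⟨m, rfl⟩ := Nat.exists_eq_add_of_lt hlt
  have : p * (d + m + 1) = p * d + p * m + p := by ring
  have := Nat.zero_le (p * m)
  have := h.left
  have := h.right
  omega

theorem IsReducedExp.eq_of_weight_eq (hp : 1 ≤ p) {a b c d e a' b' c' d' e' : ℕ}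
    (h : IsReducedExp p b c e) (h' : IsReducedExp p b' c' e')
    (hx : a + p * c + (p - 1) * e = a' + p * c' + (p - 1) * e')
    (hy : b + p * d + e = b' + p * d' + e') (hT : c + d + e = c' + d' + e') :
    a = a' ∧ b = b' ∧ c = c' ∧ d = d' ∧ e = e' := by
  obtain rfl : d = d' :=
    le_antisymm (h'.le_of_weight_eq hp hy.symm hT.symm) (h.le_of_weight_eq hp hy hT)
  have := h.left
  have := h'.left
  obtain rfl : e = e' := by omega
  obtain rfl : c = c' := by omega
  omega

/-- The ideal generated by the homogeneous equations of degree at most `N`. -/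
noncomputable def lowDegreeEqs (k : Type*) [Field k] (p N : ℕ) :
    Ideal (MvPolynomial (Fin 3) (MvPolynomial (Fin 2) k)) :=
  Ideal.span {P | P ∈ reesKer (monomialGens k p) ∧ ∃ q ≤ N, MvPolynomial.IsHomogeneous P q}

theorem binomial_mem_reesKer {a b c d e a' b' c' d' e' : ℕ}
    (hx : a + p * c + (p - 1) * e = a' + p * c' + (p - 1) * e')
    (hy : b + p * d + e = b' + p * d' + e') (hT : c + d + e = c' + d' + e') :
    biMonomial k a b c d e - biMonomial k a' b' c' d' e' ∈ reesKer (monomialGens k p) := by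
  rw [mem_reesKer, map_sub, aeval_biMonomial, aeval_biMonomial, hx, hy, hT, sub_self]

theorem binomial_mem_lowDegreeEqs {N a b c d e a' b' c' d' e' : ℕ}
    (hx : a + p * c + (p - 1) * e = a' + p * c' + (p - 1) * e')
    (hy : b + p * d + e = b' + p * d' + e') (hT : c + d + e = c' + d' + e')
    (hN : c + d + e ≤ N) :
    biMonomial k a b c d e - biMonomial k a' b' c' d' e' ∈ lowDegreeEqs k p N :=
  Ideal.subset_span ⟨binomial_mem_reesKer hx hy hT, _, hN,
    (biMonomial_isHomogeneous a b c d e).sub (hT ▸ biMonomial_isHomogeneous a' b' c' d' e')⟩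

theorem exists_isReducedExp (hp : 1 ≤ p) (a b c d e : ℕ) :
    ∃ a' b' c' d' e', IsReducedExp p b' c' e' ∧
      a + p * c + (p - 1) * e = a' + p * c' + (p - 1) * e' ∧
      b + p * d + e = b' + p * d' + e' ∧ c + d + e = c' + d' + e' ∧
      biMonomial k a b c d e - biMonomial k a' b' c' d' e' ∈ lowDegreeEqs k p p := by
  induction hn : 2 * b + e using Nat.strong_induction_on generalizing a b c d e with
  | _ n ih =>
    subst hn
    by_cases hred : IsReducedExp p b c e
    · exact ⟨a, b, c, d, e, hred, rfl, rfl, rfl, by simp⟩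
    suffices hstep : ∃ a₁ b₁ c₁ d₁ e₁, 2 * b₁ + e₁ < 2 * b + e ∧
        a + p * c + (p - 1) * e = a₁ + p * c₁ + (p - 1) * e₁ ∧
        b + p * d + e = b₁ + p * d₁ + e₁ ∧ c + d + e = c₁ + d₁ + e₁ ∧
        biMonomial k a b c d e - biMonomial k a₁ b₁ c₁ d₁ e₁ ∈ lowDegreeEqs k p p by
      obtain ⟨a₁, b₁, c₁, d₁, e₁, hlt, hx, hy, hT, hmem⟩ := hstep
      obtain ⟨a', b', c', d', e', hred', hx', hy', hT', hmem'⟩ := ih _ hlt a₁ b₁ c₁ d₁ e₁ rfl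
      refine ⟨a', b', c', d', e', hred', hx.trans hx', hy.trans hy', hT.trans hT', ?_⟩
      simpa using Ideal.add_mem _ hmem hmem'
    by_cases hbc : b = 0 ∨ c = 0
    · have he : ¬ (e = 0 ∨ b + e < p) := fun h => hred ⟨hbc, h⟩
      obtain ⟨j, q, b₀, e₀, hpq, rfl, rfl⟩ :
          ∃ j q b₀ e₀, p = q + j + 1 ∧ b = b₀ + q ∧ e = e₀ + (j + 1) :=
        ⟨min e p - 1, p - min e p, b - (p - min e p), e - min e p, by omega, by omega, by omega⟩
      have hp1 : p - 1 = q + j := by omega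
      refine ⟨a + q, b₀, c + j, d + 1, e₀, by omega, ?_, ?_, by omega, ?_⟩
      · rw [hp1, hpq]; ring
      · rw [hpq]; ring
      · have h : biMonomial k 0 q 0 0 (j + 1) - biMonomial k q 0 j 1 0 ∈ lowDegreeEqs k p p :=
          binomial_mem_lowDegreeEqs (by rw [hp1, hpq]; ring) (by rw [hpq]; ring) (by omega)
            (by omega)
        simpa only [mul_sub, biMonomial_mul, add_zero] using
          Ideal.mul_mem_left _ (biMonomial k a b₀ c d e₀) h
    · obtain ⟨b, rfl⟩ := Nat.exists_eq_succ_of_ne_zero (not_or.1 hbc).1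
      obtain ⟨c, rfl⟩ := Nat.exists_eq_succ_of_ne_zero (not_or.1 hbc).2
      obtain ⟨m, rfl⟩ := Nat.exists_eq_add_of_le' hp
      refine ⟨a + 1, b, c, d, e + 1, by omega, ?_, by omega, by omega, ?_⟩
      · simp only [Nat.add_sub_cancel, Nat.succ_eq_add_one]; ring
      · have h : biMonomial k 0 1 1 0 0 - biMonomial k 1 0 0 0 1 ∈
            lowDegreeEqs k (m + 1) (m + 1) :=
          binomial_mem_lowDegreeEqs (by simp; ring) (by simp) (by omega) (by omega)
        simpa only [mul_sub, biMonomial_mul, add_zero] using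
          Ideal.mul_mem_left _ (biMonomial k a b c d e) h

theorem binomial_mem_lowDegreeEqs_self (hp : 1 ≤ p) {a b c d e a' b' c' d' e' : ℕ}
    (hx : a + p * c + (p - 1) * e = a' + p * c' + (p - 1) * e')
    (hy : b + p * d + e = b' + p * d' + e') (hT : c + d + e = c' + d' + e') :
    biMonomial k a b c d e - biMonomial k a' b' c' d' e' ∈ lowDegreeEqs k p p := by
  obtain ⟨a₁, b₁, c₁, d₁, e₁, hr₁, hx₁, hy₁, hT₁, h₁⟩ :=
    exists_isReducedExp (k := k) hp a b c d e
  obtain ⟨a₂, b₂, c₂, d₂, e₂, hr₂, hx₂, hy₂, hT₂, h₂⟩ :=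
    exists_isReducedExp (k := k) hp a' b' c' d' e'
  obtain ⟨rfl, rfl, rfl, rfl, rfl⟩ := hr₁.eq_of_weight_eq hp hr₂
    (hx₁.symm.trans (hx.trans hx₂)) (hy₁.symm.trans (hy.trans hy₂))
    (hT₁.symm.trans (hT.trans hT₂))
  simpa using Ideal.sub_mem _ h₁ h₂

theorem monomial_monomial_eq_biMonomial (m : Fin 2 →₀ ℕ) (n : Fin 3 →₀ ℕ) :
    MvPolynomial.monomial n (MvPolynomial.monomial m (1 : k)) =
      biMonomial k (m 0) (m 1) (n 0) (n 1) (n 2) := by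
  rw [MvPolynomial.monomial_eq, MvPolynomial.monomial_eq, biMonomial,
    Finsupp.prod_fintype _ _ (by simp), Finsupp.prod_fintype _ _ (by simp)]
  simp [Fin.prod_univ_two, Fin.prod_univ_three]

/-- The presentation kernel is spanned by binomials, hence generated in degree at most `p`. -/
theorem reesKer_monomialGens_le (hp : 1 ≤ p) :
    reesKer (monomialGens k p) ≤ lowDegreeEqs k p p := by
  classical
  let J := lowDegreeEqs k p p
  let π : MvPolynomial (Fin 3) (MvPolynomial (Fin 2) k) →ₗ[k] Polynomial (MvPolynomial (Fin 2) k) :=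
    (MvPolynomial.aeval
      (fun i => Polynomial.C (monomialGens k p i) * Polynomial.X)).toLinearMap.restrictScalars k
  let lifts (w : (Fin 2 →₀ ℕ) × ℕ) (v : (Fin 2 →₀ ℕ) × (Fin 3 →₀ ℕ)) : Prop :=
    v.1 0 + p * v.2 0 + (p - 1) * v.2 2 = w.1 0 ∧ v.1 1 + p * v.2 1 + v.2 2 = w.1 1 ∧
      v.2 0 + v.2 1 + v.2 2 = w.2
  let B := (MvPolynomial.basisMonomials (Fin 2) k).smulTower
    (Polynomial.basisMonomials (MvPolynomial (Fin 2) k))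
  let σ : Polynomial (MvPolynomial (Fin 2) k) →ₗ[k] _ ⧸ J :=
    B.constr k fun w => if h : ∃ v, lifts w v then
      Ideal.Quotient.mk J (MvPolynomial.monomial h.choose.2
        (MvPolynomial.monomial h.choose.1 (1 : k))) else 0
  have key : σ ∘ₗ π = (Ideal.Quotient.mkₐ k J).toLinearMap := by
    refine ((MvPolynomial.basisMonomials (Fin 2) k).smulTower
      (MvPolynomial.basisMonomials (Fin 3) (MvPolynomial (Fin 2) k))).ext fun ⟨m, n⟩ => ?_
    let w : (Fin 2 →₀ ℕ) × ℕ := (Finsupp.equivFunOnFinite.symm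
      ![m 0 + p * n 0 + (p - 1) * n 2, m 1 + p * n 1 + n 2], n 0 + n 1 + n 2)
    have hw : ∃ v, lifts w v := ⟨(m, n), by simp [lifts, w]⟩
    have hπ : π (MvPolynomial.monomial n (MvPolynomial.monomial m (1 : k))) = B w := by
      rw [monomial_monomial_eq_biMonomial]
      refine (aeval_biMonomial p _ _ _ _ _).trans ?_
      simp only [B, Module.Basis.smulTower_apply, MvPolynomial.coe_basisMonomials,
        Polynomial.coe_basisMonomials, Polynomial.smul_monomial]
      rw [smul_eq_mul, mul_one, ← Polynomial.C_mul_X_pow_eq_monomial, MvPolynomial.monomial_eq,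
        Finsupp.prod_fintype _ _ (by simp)]
      simp [Fin.prod_univ_two, w]
    have hbasis : ((MvPolynomial.basisMonomials (Fin 2) k).smulTower
        (MvPolynomial.basisMonomials (Fin 3) (MvPolynomial (Fin 2) k))) (m, n) =
        MvPolynomial.monomial n (MvPolynomial.monomial m (1 : k)) := by
      simp [Module.Basis.smulTower_apply, MvPolynomial.smul_monomial]
    rw [hbasis, LinearMap.comp_apply, hπ]
    simp only [σ, Module.Basis.constr_basis, dif_pos hw]
    obtain ⟨h0, h1, h2⟩ := hw.choose_spec
    refine (Ideal.Quotient.mk_eq_mk_iff_sub_mem _ _).2 ?_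
    rw [monomial_monomial_eq_biMonomial, monomial_monomial_eq_biMonomial]
    exact binomial_mem_lowDegreeEqs_self hp (by rw [h0]; simp [w]) (by rw [h1]; simp [w])
      (by rw [h2])
  intro P hP
  have hP0 : π P = 0 := hP
  have h := LinearMap.congr_fun key P
  rw [LinearMap.comp_apply, hP0, map_zero] at h
  exact Ideal.Quotient.eq_zero_iff_mem.1 h.symm

theorem genInDegLE_monomialGens (hp : 1 ≤ p) : GenInDegLE (reesKer (monomialGens k p)) p :=
  le_antisymm (reesKer_monomialGens_le hp) (Ideal.span_le.2 fun _ hP => hP.1)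

/-- Homogeneous equations of degree less than `p` vanish modulo `(x, y)`. -/
theorem constantCoeff_coeff_eq_zero {P : MvPolynomial (Fin 3) (MvPolynomial (Fin 2) k)}
    (hP : P ∈ reesKer (monomialGens k p)) {q : ℕ} (hq : q < p) (hh : P.IsHomogeneous q)
    (n₀ : Fin 3 →₀ ℕ) : MvPolynomial.constantCoeff (P.coeff n₀) = 0 := by
  by_cases hn₀ : P.coeff n₀ = 0
  · simp [hn₀]
  have hdeg {n : Fin 3 →₀ ℕ} (hn : P.coeff n ≠ 0) : n 0 + n 1 + n 2 = q := by
    have := hh hn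
    simpa [Finsupp.weight_apply, Finsupp.sum_fintype, Fin.sum_univ_three] using this
  let w (n : Fin 3 →₀ ℕ) : Fin 2 →₀ ℕ := Finsupp.equivFunOnFinite.symm
    ![p * n 0 + (p - 1) * n 2, p * n 1 + n 2]
  have heval : ∑ n ∈ P.support, P.coeff n * MvPolynomial.monomial (w n) 1 = 0 := by
    have h := congrArg (Polynomial.eval 1) (mem_reesKer.1 hP)
    rw [MvPolynomial.aeval_def, MvPolynomial.eval₂_eq', Polynomial.eval_finsetSum,
      Polynomial.eval_zero] at h
    rw [← h]
    refine Finset.sum_congr rfl fun n _ => ?_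
    rw [MvPolynomial.monomial_eq, Finsupp.prod_fintype _ _ (by simp)]
    simp only [Fin.prod_univ_two, Fin.prod_univ_three, monomialGens, w,
      Polynomial.algebraMap_apply, Algebra.algebraMap_self, RingHom.id_apply, Polynomial.eval_mul,
      Polynomial.eval_pow, Polynomial.eval_C, Polynomial.eval_X, Matrix.cons_val_zero,
      Matrix.cons_val_one, Matrix.cons_val, Finsupp.equivFunOnFinite_symm_apply_apply, map_one]
    ring
  have hle {n : Fin 3 →₀ ℕ} (hn : P.coeff n ≠ 0) (hw : w n ≤ w n₀) : n = n₀ := by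
    have h0 : p * n 0 + (p - 1) * n 2 ≤ p * n₀ 0 + (p - 1) * n₀ 2 := hw 0
    have h1 : p * n 1 + n 2 ≤ p * n₀ 1 + n₀ 2 := hw 1
    have hd := hdeg hn
    have hd₀ := hdeg hn₀
    obtain ⟨m, rfl⟩ := Nat.exists_eq_add_of_lt (Nat.zero_lt_of_lt hq)
    simp only [zero_add, Nat.add_sub_cancel] at h0 h1
    have hs : (m + 1) * n 0 + m * n 2 + ((m + 1) * n 1 + n 2) =
        (m + 1) * n₀ 0 + m * n₀ 2 + ((m + 1) * n₀ 1 + n₀ 2) := by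
      calc _ = (m + 1) * (n 0 + n 1 + n 2) := by ring
        _ = (m + 1) * (n₀ 0 + n₀ 1 + n₀ 2) := by rw [hd, hd₀]
        _ = _ := by ring
    have h1' : n 2 + (m + 1) * n 1 = n₀ 2 + (m + 1) * n₀ 1 := by omega
    have h2 : n 2 = n₀ 2 := by
      have := congrArg (· % (m + 1)) h1'
      simp only [Nat.add_mul_mod_self_left] at this
      rwa [Nat.mod_eq_of_lt (by omega), Nat.mod_eq_of_lt (by omega)] at this
    have h3 : n 1 = n₀ 1 := by
      refine Nat.eq_of_mul_eq_mul_left (Nat.succ_pos m) ?_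
      rw [Nat.succ_eq_add_one]
      omega
    ext i
    fin_cases i
    · simp only [Fin.zero_eta]; omega
    · exact h3
    · exact h2
  have h := congrArg (MvPolynomial.coeff (w n₀)) heval
  rw [MvPolynomial.coeff_sum, Finset.sum_eq_single n₀, MvPolynomial.coeff_mul_monomial',
    if_pos le_rfl, tsub_self, mul_one, MvPolynomial.coeff_zero] at h
  · exact h
  · intro n hn hne
    rw [MvPolynomial.coeff_mul_monomial',
      if_neg fun hw => hne (hle (MvPolynomial.mem_support_iff.1 hn) hw)]
  · intro hn
    exact absurd (MvPolynomial.mem_support_iff.2 hn₀) hn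

theorem le_of_genInDegLE_monomialGens {N : ℕ}
    (h : GenInDegLE (reesKer (monomialGens k p)) N) : p ≤ N := by
  by_contra! hN
  obtain ⟨m, rfl⟩ := Nat.exists_eq_add_of_lt (Nat.zero_lt_of_lt hN)
  have hmem : biMonomial k 0 0 0 0 (0 + m + 1) - biMonomial k 0 0 m 1 0 ∈
      reesKer (monomialGens k (0 + m + 1)) :=
    binomial_mem_reesKer (by simp; ring) (by simp) (by omega)
  rw [h] at hmem
  have hker : biMonomial k 0 0 0 0 (0 + m + 1) - biMonomial k 0 0 m 1 0 ∈
      RingHom.ker (MvPolynomial.map (σ := Fin 3)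
        (MvPolynomial.constantCoeff (σ := Fin 2) (R := k))) := by
    refine Ideal.span_le.2 ?_ hmem
    rintro P ⟨hP, q, hq, hh⟩
    refine MvPolynomial.ext _ _ fun n => ?_
    rw [MvPolynomial.coeff_map, MvPolynomial.coeff_zero]
    exact constantCoeff_coeff_eq_zero hP (hq.trans_lt hN) hh n
  have hz := congrArg (MvPolynomial.eval ![(0 : k), 0, 1]) (RingHom.mem_ker.1 hker)
  simp [biMonomial] at hz

end MonomialIdeal

/-- For `p ≥ 1`, the ideal `I = (x^p, y^p, x^{p-1}y)` of `k[x,y]` has relation type `p`. -/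
theorem relType_monomial_ideal {k : Type*} [Field k] (p : ℕ) (hp : 1 ≤ p) :
    relType (Ideal.span {(X 0 : MvPolynomial (Fin 2) k) ^ p, X 1 ^ p,
      X 0 ^ (p - 1) * X 1}) = p := by
  rw [← span_range_monomialGens]
  refine le_antisymm (Nat.sInf_le ⟨hp, fun s f hf =>
    (genInDegLE_monomialGens hp).of_span_eq hp hf⟩) (le_csInf ⟨p, hp, fun s f hf =>
    (genInDegLE_monomialGens hp).of_span_eq hp hf⟩ ?_)
  rintro N ⟨-, hN⟩
  exact le_of_genInDegLE_monomialGens (hN 3 _ rfl)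
end
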